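/- arXiv:1106.5444 — 2 statements merged into one kernel-verified Lean document; each statement's English description precedes it below -/
import Mathlib

section
/- (Jakšetić–Pečarić lower bound.) Let f : [0,∞) → [0,∞) be strictly increasing and differentiable with f(0) = 0 and lim_{x→∞} f(x) = ∞, let b > 0 and c > f(b), and suppose the derivative f′ is increasing on the interval [min{f⁻¹(c), b}, max{f⁻¹(c), b}]. Then ∫_0^b f(x) dx + ∫_0^c f⁻¹(y) dy − bc ≥ (1/2)·(f⁻¹(c) − b)·(c − f(b)). -/
open MeasureTheory Set Filter intervalIntegral

/-- The inverse of a strictly increasing bijection of `[0, ∞)` is continuous on `[0, ∞)`. -/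
lemma continuousOn_inverse_Ici {f g : ℝ → ℝ} (hf_mono : StrictMonoOn f (Ici 0))
    (hf_nonneg : ∀ x, 0 ≤ x → 0 ≤ f x)
    (hg_left : ∀ x, 0 ≤ x → g (f x) = x) (hg_right : ∀ y, 0 ≤ y → f (g y) = y)
    (hg_nonneg : ∀ y, 0 ≤ y → 0 ≤ g y) : ContinuousOn g (Ici 0) := by
  have hmaps : MapsTo g (Ici 0) (Ici 0) := hg_nonneg
  have hmono : Monotone (hmaps.restrict g (Ici 0) (Ici 0)) := by
    rintro ⟨x, hx⟩ ⟨y, hy⟩ hxy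
    change g x ≤ g y
    rw [← hf_mono.le_iff_le (hg_nonneg x hx) (hg_nonneg y hy), hg_right x hx, hg_right y hy]
    exact hxy
  have hsurj : Function.Surjective (hmaps.restrict g (Ici 0) (Ici 0)) := by
    rintro ⟨x, hx⟩
    exact ⟨⟨f x, hf_nonneg x hx⟩, Subtype.ext (hg_left x hx)⟩
  rw [continuousOn_iff_continuous_domRestrict]
  exact continuous_subtype_val.comp (hmono.continuous_of_surjective hsurj)

/-- The equality case of Young's inequality: the areas under a differentiable function and under
its left inverse fill a rectangle. -/
lemma integral_add_integral_inverse_eq_mul {f g f' : ℝ → ℝ}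
    (hf_nonneg : ∀ x, 0 ≤ x → 0 ≤ f x) (hf0 : f 0 = 0)
    (hg_left : ∀ x, 0 ≤ x → g (f x) = x) (hg_cont : ContinuousOn g (Ici 0))
    (hf_deriv : ∀ x, 0 ≤ x → HasDerivAt f (f' x) x) {a : ℝ} (ha : 0 ≤ a) :
    (∫ x in (0:ℝ)..a, f x) + (∫ y in (0:ℝ)..f a, g y) = a * f a := by
  have hf_cont : ContinuousOn f (Ici 0) := fun x hx ↦ (hf_deriv x hx).continuousAt.continuousWithinAt
  have hmax : Continuous fun x : ℝ ↦ max x 0 := by fun_prop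
  have hF : Continuous fun x ↦ f (max x 0) :=
    hf_cont.comp_continuous hmax fun x ↦ le_max_right x 0
  have hG : Continuous fun x ↦ g (max x 0) :=
    hg_cont.comp_continuous hmax fun x ↦ le_max_right x 0
  have extend (h : ℝ → ℝ) {u : ℝ} (hu : 0 ≤ u) :
      ∫ x in (0:ℝ)..u, h x = ∫ x in (0:ℝ)..u, h (max x 0) := by
    refine integral_congr fun x hx ↦ ?_
    rw [uIcc_of_le hu] at hx
    simp only [max_eq_left hx.1]
  have hderiv : ∀ x, 0 ≤ x → HasDerivAt (fun t ↦ (∫ s in (0:ℝ)..t, f (max s 0)) +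
      (∫ s in (0:ℝ)..f t, g (max s 0)) - t * f t) 0 x := by
    intro x hx
    have h1 := hF.integral_hasStrictDerivAt 0 x |>.hasDerivAt
    have h2 := (hG.integral_hasStrictDerivAt 0 (f x)).hasDerivAt.comp x (hf_deriv x hx)
    have h3 := (hasDerivAt_id x).mul (hf_deriv x hx)
    refine ((h1.add h2).sub h3).congr_deriv ?_
    simp only [max_eq_left hx, max_eq_left (hf_nonneg x hx), hg_left x hx, id]
    ring
  have hconst := constant_of_has_deriv_right_zero (a := 0) (b := a)
    (fun x hx ↦ (hderiv x hx.1).continuousAt.continuousWithinAt)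
    (fun x hx ↦ (hderiv x hx.1).hasDerivWithinAt) a (right_mem_Icc.2 ha)
  simp only [hf0, integral_same] at hconst
  rw [extend f ha, extend g (hf_nonneg a ha)]
  linarith

/-- The right-hand Hermite–Hadamard inequality. -/
lemma ConvexOn.integral_le_trapezoid {f : ℝ → ℝ} {a b : ℝ} (hab : a < b)
    (hf : ConvexOn ℝ (Icc a b) f) (hf_cont : ContinuousOn f (Icc a b)) :
    ∫ x in a..b, f x ≤ (b - a) * (f a + f b) / 2 := by
  have hba : 0 < b - a := sub_pos.2 hab
  have hchord : ∀ x ∈ Icc a b, f x ≤ f a + (f b - f a) / (b - a) * (x - a) := by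
    intro x hx
    have h := hf.2 (left_mem_Icc.2 hab.le) (right_mem_Icc.2 hab.le)
      (div_nonneg (sub_nonneg.2 hx.2) hba.le) (div_nonneg (sub_nonneg.2 hx.1) hba.le)
      (by field_simp; ring)
    simp only [smul_eq_mul] at h
    have hx' : (b - x) / (b - a) * a + (x - a) / (b - a) * b = x := by
      field_simp
      ring
    rw [hx'] at h
    refine h.trans_eq ?_
    field_simp
    ring
  refine (integral_mono_on hab.le (hf_cont.intervalIntegrable_of_Icc hab.le)
    (Continuous.intervalIntegrable (by fun_prop) a b) hchord).trans_eq ?_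
  rw [intervalIntegral.integral_add (by simp) (Continuous.intervalIntegrable (by fun_prop) a b),
    intervalIntegral.integral_const_mul, intervalIntegral.integral_sub (by simp) (by simp)]
  simp only [intervalIntegral.integral_const, integral_id, smul_eq_mul]
  field_simp
  ring

/-- The Jakšetić–Pečarić lower bound: if `f` is increasing and differentiable with an
increasing derivative on the interval between `f⁻¹(c)` and `b`, and `c > f(b)`, then
`∫_0^b f + ∫_0^c f⁻¹ - bc ≥ (1/2)(f⁻¹(c) - b)(c - f(b))`. -/
theorem jaksetic_pecaric_lower (f g f' : ℝ → ℝ)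
    (hf_mono : StrictMonoOn f (Set.Ici 0))
    (hf_cont : ContinuousOn f (Set.Ici 0))
    (hf_nonneg : ∀ x, 0 ≤ x → 0 ≤ f x)
    (hf0 : f 0 = 0)
    (hf_tendsto : Filter.Tendsto f Filter.atTop Filter.atTop)
    (hg_left : ∀ x, 0 ≤ x → g (f x) = x)
    (hg_right : ∀ y, 0 ≤ y → f (g y) = y)
    (hg_nonneg : ∀ y, 0 ≤ y → 0 ≤ g y)
    (hf_deriv : ∀ x, 0 ≤ x → HasDerivAt f (f' x) x)
    (b c : ℝ) (hb : 0 < b) (hc : f b < c)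
    (hf'_mono : MonotoneOn f' (Set.Icc (min (g c) b) (max (g c) b))) :
    (∫ x in (0:ℝ)..b, f x) + (∫ y in (0:ℝ)..c, g y) - b * c ≥
      (1 / 2) * (g c - b) * (c - f b) := by
  have hc0 : 0 ≤ c := (hf_nonneg b hb.le).trans hc.le
  have hfa : f (g c) = c := hg_right c hc0
  have ha : 0 ≤ g c := hg_nonneg c hc0
  have hba : b < g c := by
    rwa [← hf_mono.lt_iff_lt hb.le ha, hfa]
  rw [min_eq_right hba.le, max_eq_left hba.le] at hf'_mono
  have hcont : ContinuousOn f (Icc b (g c)) :=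
    hf_cont.mono fun x hx ↦ hb.le.trans hx.1
  have hconv : ConvexOn ℝ (Icc b (g c)) f := by
    have hd : ∀ x ∈ interior (Icc b (g c)), HasDerivAt f (f' x) x := fun x hx ↦
      hf_deriv x (hb.le.trans (interior_subset hx).1)
    refine MonotoneOn.convexOn_of_deriv (convex_Icc _ _) hcont
      (fun x hx ↦ (hd x hx).differentiableAt.differentiableWithinAt) ?_
    exact (hf'_mono.mono interior_subset).congr fun x hx ↦ (hd x hx).deriv.symm
  have htrap := hconv.integral_le_trapezoid hba hcont
  have hyoung := integral_add_integral_inverse_eq_mul hf_nonneg hf0 hg_left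
    (continuousOn_inverse_Ici hf_mono hf_nonneg hg_left hg_right hg_nonneg) hf_deriv ha
  have hsplit : (∫ x in (0:ℝ)..b, f x) + ∫ x in b..g c, f x = ∫ x in (0:ℝ)..g c, f x :=
    integral_add_adjacent_intervals
      ((hf_cont.mono fun x hx ↦ hx.1).intervalIntegrable_of_Icc hb.le)
      (hcont.intervalIntegrable_of_Icc hba.le)
  rw [hfa] at htrap hyoung
  linarith
end

section
/- (c-conjugacy of the Young pair.) Let K : [a,b] × [A,B] → (0,∞) be Lebesgue integrable and strictly positive almost everywhere, define the cost function c(x,y) = ∫_a^x ∫_A^y K(s,t) dt ds, and let f : [a,b] → [A,B] be a nondecreasing function with f(a) = A and f(b) = B, with pseudo-inverse f_sup⁻¹(t) = inf{x ∈ [a,b] : f(x) > t} (inf ∅ = b). Define F(x) = ∫_a^x (∫_A^{f(s)} K(s,t) dt) ds for x ∈ [a,b] and G(y) = ∫_A^y (∫_a^{f_sup⁻¹(t)} K(s,t) ds) dt for y ∈ [A,B]. Then F(x) = sup{ c(x,y) − G(y) : y ∈ [A,B] } for every x ∈ [a,b], and G(y) = sup{ c(x,y) − F(x) : x ∈ [a,b]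 } for every y ∈ [A,B]; i.e., F and G are c-conjugate, and in particular both are c-convex. -/
open MeasureTheory Set Filter intervalIntegral Classical

/-- The integral over a subgraph inside a rectangle, as an iterated interval integral. -/
theorem integral_integral_eq_setIntegral_subgraph {a b A B x : ℝ} {K : ℝ → ℝ → ℝ} {φ : ℝ → ℝ}
    (hK : IntegrableOn (fun p : ℝ × ℝ => K p.1 p.2) (Icc a b ×ˢ Icc A B))
    (hφ : Measurable φ) (hmaps : ∀ s ∈ Icc a b, φ s ∈ Icc A B) (hx : x ∈ Icc a b) :
    ∫ s in a..x, ∫ t in A..φ s, K s t =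
      ∫ p in (Icc a b ×ˢ Icc A B) ∩ {p : ℝ × ℝ | p.1 ≤ x ∧ p.2 ≤ φ p.1}, K p.1 p.2 := by
  have hmeas : MeasurableSet
      ((Icc a b ×ˢ Icc A B) ∩ {p : ℝ × ℝ | p.1 ≤ x ∧ p.2 ≤ φ p.1}) :=
    (measurableSet_Icc.prod measurableSet_Icc).inter
      ((measurableSet_le measurable_fst measurable_const).inter
        (measurableSet_le measurable_snd (hφ.comp measurable_fst)))
  have hint := (hK.mono_set inter_subset_left).integrable_indicator hmeas
  rw [← MeasureTheory.integral_indicator hmeas, Measure.volume_eq_prod, integral_prod _ hint,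
    integral_of_le hx.1, ← integral_Icc_eq_integral_Ioc, ← MeasureTheory.integral_indicator measurableSet_Icc]
  refine integral_congr_ae (Eventually.of_forall fun s => ?_)
  by_cases hs : s ∈ Icc a x
  · have hsb : s ∈ Icc a b := ⟨hs.1, hs.2.trans hx.2⟩
    have hφs := hmaps s hsb
    simp only [indicator_of_mem hs]
    rw [integral_of_le hφs.1, ← integral_Icc_eq_integral_Ioc,
      ← MeasureTheory.integral_indicator measurableSet_Icc]
    refine integral_congr_ae (Eventually.of_forall fun t => ?_)
    simp only [indicator_apply]
    refine if_congr ⟨fun ht => ?_, fun ht => ⟨ht.1.2.1, ht.2.2⟩⟩ rfl rfl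
    exact ⟨⟨hsb, ht.1, ht.2.trans hφs.2⟩, hs.2, ht.2⟩
  · simp only [indicator_of_notMem hs]
    refine (integral_eq_zero_of_ae (Eventually.of_forall fun t => ?_)).symm
    exact indicator_of_notMem (fun h => hs ⟨h.1.1.1, h.2.1⟩) _

/-- The graph of a measurable function is a null set. -/
theorem volume_graph_eq_zero {φ : ℝ → ℝ} (hφ : Measurable φ) :
    volume {p : ℝ × ℝ | p.2 = φ p.1} = 0 := by
  have hmeas : MeasurableSet {p : ℝ × ℝ | p.2 = φ p.1} :=
    measurableSet_eq_fun measurable_snd (hφ.comp measurable_fst)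
  rw [Measure.volume_eq_prod, Measure.measure_prod_null hmeas]
  exact Eventually.of_forall fun s => measure_singleton (φ s)

/-- The graph of a measurable function of the second coordinate is a null set. -/
theorem volume_graph_swap_eq_zero {ψ : ℝ → ℝ} (hψ : Measurable ψ) :
    volume {p : ℝ × ℝ | p.1 = ψ p.2} = 0 := by
  have hmeas : MeasurableSet {p : ℝ × ℝ | p.1 = ψ p.2} :=
    measurableSet_eq_fun measurable_fst (hψ.comp measurable_snd)
  have h : MeasurePreserving (Prod.swap : ℝ × ℝ → ℝ × ℝ) volume volume :=
    Measure.measurePreserving_swap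
  rw [← h.measure_preimage hmeas.nullMeasurableSet]
  exact volume_graph_eq_zero hψ

/-- Integration over the region to the left of a graph in the second coordinate. -/
theorem integral_integral_eq_setIntegral_subgraph_swap {a b A B y : ℝ} {K : ℝ → ℝ → ℝ} {ψ : ℝ → ℝ}
    (hK : IntegrableOn (fun p : ℝ × ℝ => K p.1 p.2) (Icc a b ×ˢ Icc A B))
    (hψ : Measurable ψ) (hmaps : ∀ t ∈ Icc A B, ψ t ∈ Icc a b) (hy : y ∈ Icc A B) :
    ∫ t in A..y, ∫ s in a..ψ t, K s t =
      ∫ p in (Icc a b ×ˢ Icc A B) ∩ {p : ℝ × ℝ | p.2 ≤ y ∧ p.1 ≤ ψ p.2}, K p.1 p.2 := by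
  have h : MeasurePreserving (Prod.swap : ℝ × ℝ → ℝ × ℝ) volume volume :=
    Measure.measurePreserving_swap
  have he : MeasurableEmbedding (Prod.swap : ℝ × ℝ → ℝ × ℝ) :=
    MeasurableEquiv.prodComm.measurableEmbedding
  have hK' : IntegrableOn (fun p : ℝ × ℝ => K p.2 p.1) (Icc A B ×ˢ Icc a b) := by
    have := (h.integrableOn_comp_preimage he).2 hK
    rwa [preimage_swap_prod] at this
  rw [integral_integral_eq_setIntegral_subgraph (K := fun t s => K s t) hK' hψ hmaps hy,
    ← h.setIntegral_preimage_emb he]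
  congr 2
  ext p
  simp only [mem_inter_iff, mem_prod, mem_preimage, mem_ofPred_eq, Prod.fst_swap, Prod.snd_swap]
  tauto

/-- The c-conjugacy of the Young pair: for the cost `c(x,y) = ∫_a^x ∫_A^y K` with `K`
integrable and a.e. strictly positive, a nondecreasing surjection-like
`f : [a,b] → [A,B]` with `f a = A`, `f b = B`, and the functions
`F(x) = ∫_a^x ∫_A^{f(s)} K` and `G(y) = ∫_A^y ∫_a^{finv(t)} K`, one has `F = Gᶜ` and
`G = Fᶜ`; in particular both are c-convex. -/
theorem young_pair_c_conjugate (a b A B : ℝ) (hab : a < b) (hAB : A < B)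
    (K : ℝ → ℝ → ℝ) (c : ℝ → ℝ → ℝ) (f finv F G : ℝ → ℝ)
    (hK_nonneg : ∀ x y, x ∈ Set.Icc a b → y ∈ Set.Icc A B → 0 ≤ K x y)
    (hK_int : MeasureTheory.IntegrableOn (fun p : ℝ × ℝ => K p.1 p.2)
      (Set.Icc a b ×ˢ Set.Icc A B))
    (hK_pos : ∀ᵐ p : ℝ × ℝ, p ∈ Set.Icc a b ×ˢ Set.Icc A B → 0 < K p.1 p.2)
    (hc : ∀ x y, c x y = ∫ s in a..x, ∫ t in A..y, K s t)
    (hf_mono : MonotoneOn f (Set.Icc a b))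
    (hf_maps : ∀ x ∈ Set.Icc a b, f x ∈ Set.Icc A B)
    (hfa : f a = A) (hfb : f b = B)
    (hfinv : ∀ t, finv t =
      if {x : ℝ | x ∈ Set.Icc a b ∧ t < f x}.Nonempty
        then sInf {x : ℝ | x ∈ Set.Icc a b ∧ t < f x} else b)
    (hF : ∀ x, F x = ∫ s in a..x, ∫ t in A..f s, K s t)
    (hG : ∀ y, G y = ∫ t in A..y, ∫ s in a..finv t, K s t) :
    (∀ x ∈ Set.Icc a b, F x = sSup ((fun y => c x y - G y) '' Set.Icc A B)) ∧
    (∀ y ∈ Set.Icc A B, G y = sSup ((fun x => c x y - F x) '' Set.Icc a b)) := by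
  have hR : MeasurableSet (Icc a b ×ˢ Icc A B) := measurableSet_Icc.prod measurableSet_Icc
  have hfinv_mem : ∀ t, finv t ∈ Icc a b := by
    intro t
    rw [hfinv]
    split_ifs with hne
    · have hbdd : BddBelow {x : ℝ | x ∈ Icc a b ∧ t < f x} := ⟨a, fun x hx => hx.1.1⟩
      obtain ⟨x, hx⟩ := hne
      exact ⟨le_csInf ⟨x, hx⟩ fun z hz => hz.1.1, (csInf_le hbdd hx).trans hx.1.2⟩
    · exact ⟨hab.le, le_rfl⟩
  have finv_le : ∀ t, ∀ s ∈ Icc a b, t < f s → finv t ≤ s := by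
    intro t s hs hts
    rw [hfinv, if_pos ⟨s, hs, hts⟩]
    exact csInf_le ⟨a, fun x hx => hx.1.1⟩ ⟨hs, hts⟩
  have le_finv : ∀ t, ∀ s ∈ Icc a b, f s ≤ t → s ≤ finv t := by
    intro t s hs hts
    rw [hfinv]
    split_ifs with hne
    · refine le_csInf hne fun z hz => le_of_not_gt fun hzs => ?_
      exact (hz.2.trans_le (hf_mono hz.1 hs hzs.le)).not_ge hts
    · exact hs.2
  have hfinv_mono : Monotone finv := by
    intro t t' htt
    by_contra! hlt
    have hm : (finv t + finv t') / 2 ∈ Icc a b := by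
      have h1 := hfinv_mem t
      have h2 := hfinv_mem t'
      constructor <;> linarith [h1.1, h1.2, h2.1, h2.2]
    rcases le_or_gt (f ((finv t + finv t') / 2)) t' with h | h
    · linarith [le_finv _ _ hm h]
    · linarith [finv_le _ _ hm (htt.trans_lt h)]
  set g : ℝ → ℝ := fun s => f (projIcc a b hab.le s) with hg
  have hg_eq : ∀ s ∈ Icc a b, g s = f s := fun s hs => by
    simp only [hg, projIcc_of_mem hab.le hs]
  have hg_mono : Monotone g := fun s s' h =>
    hf_mono (projIcc a b hab.le s).2 (projIcc a b hab.le s').2 (monotone_projIcc hab.le h)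
  set k : ℝ × ℝ → ℝ := fun p => K p.1 p.2 with hk
  set C : ℝ → ℝ → Set (ℝ × ℝ) := fun x y =>
    (Icc a b ×ˢ Icc A B) ∩ {p : ℝ × ℝ | p.1 ≤ x ∧ p.2 ≤ y} with hC
  set U : ℝ → Set (ℝ × ℝ) := fun x =>
    (Icc a b ×ˢ Icc A B) ∩ {p : ℝ × ℝ | p.1 ≤ x ∧ p.2 ≤ g p.1} with hU
  set V : ℝ → Set (ℝ × ℝ) := fun y =>
    (Icc a b ×ˢ Icc A B) ∩ {p : ℝ × ℝ | p.2 ≤ y ∧ p.1 ≤ finv p.2} with hV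
  have hcI : ∀ x ∈ Icc a b, ∀ y ∈ Icc A B, c x y = ∫ p in C x y, k p := fun x hx y hy => by
    rw [hc]
    exact integral_integral_eq_setIntegral_subgraph (φ := fun _ => y) hK_int measurable_const
      (fun _ _ => hy) hx
  have hFI : ∀ x ∈ Icc a b, F x = ∫ p in U x, k p := fun x hx => by
    rw [hF, ← integral_integral_eq_setIntegral_subgraph hK_int hg_mono.measurable
      (fun s hs => (hg_eq s hs).symm ▸ hf_maps s hs) hx]
    refine integral_congr fun s hs => ?_
    rw [uIcc_of_le hx.1] at hs
    simp only [hg_eq s ⟨hs.1, hs.2.trans hx.2⟩]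
  have hGI : ∀ y ∈ Icc A B, G y = ∫ p in V y, k p := fun y hy => by
    rw [hG]
    exact integral_integral_eq_setIntegral_subgraph_swap hK_int hfinv_mono.measurable
      (fun t _ => hfinv_mem t) hy
  have hV_meas : ∀ y, MeasurableSet (V y) := fun y => hR.inter
    ((measurableSet_le measurable_snd measurable_const).inter
      (measurableSet_le measurable_fst (hfinv_mono.measurable.comp measurable_snd)))
  have hU_meas : ∀ x, MeasurableSet (U x) := fun x => hR.inter
    ((measurableSet_le measurable_fst measurable_const).inter
      (measurableSet_le measurable_snd (hg_mono.measurable.comp measurable_fst)))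
  have hU_int : ∀ x, IntegrableOn k (U x) := fun x => hK_int.mono_set inter_subset_left
  have hV_int : ∀ y, IntegrableOn k (V y) := fun y => hK_int.mono_set inter_subset_left
  have hdisj : ∀ x y, AEDisjoint volume (U x) (V y) := by
    intro x y
    refine measure_mono_null ?_ (measure_union_null (volume_graph_eq_zero hg_mono.measurable)
      (volume_graph_swap_eq_zero hfinv_mono.measurable))
    rintro p ⟨⟨hp, -, h1⟩, -, -, h2⟩
    rcases h1.eq_or_lt with h | h
    · exact Or.inl h
    · rw [hg_eq _ hp.1] at h
      exact Or.inr (le_antisymm h2 (finv_le _ _ hp.1 h))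
  have hUV : ∀ x y, ∫ p in U x ∪ V y, k p = (∫ p in U x, k p) + ∫ p in V y, k p := fun x y =>
    setIntegral_union₀ (hdisj x y) (hV_meas y).nullMeasurableSet (hU_int x) (hV_int y)
  have hsub : ∀ x y, C x y ⊆ U x ∪ V y := by
    rintro x y p ⟨hp, hpx, hpy⟩
    rcases le_or_gt p.2 (g p.1) with h | h
    · exact Or.inl ⟨hp, hpx, h⟩
    · rw [hg_eq _ hp.1] at h
      exact Or.inr ⟨hp, hpy, le_finv _ _ hp.1 h.le⟩
  have young : ∀ x ∈ Icc a b, ∀ y ∈ Icc A B, c x y ≤ F x + G y := by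
    intro x hx y hy
    rw [hcI x hx y hy, hFI x hx, hGI y hy, ← hUV]
    refine setIntegral_mono_set ((hU_int x).union (hV_int y)) ?_ (hsub x y).eventuallyLE
    refine (ae_restrict_iff' ((hU_meas x).union (hV_meas y))).2 (Eventually.of_forall fun p hp => ?_)
    rcases hp with hp | hp <;> exact hK_nonneg _ _ hp.1.1 hp.1.2
  have young_eq : ∀ x ∈ Icc a b, ∀ y ∈ Icc A B, ∀ N : Set (ℝ × ℝ), volume N = 0 →
      U x ∪ V y ⊆ C x y ∪ N → c x y = F x + G y := by
    intro x hx y hy N hN h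
    rw [hcI x hx y hy, hFI x hx, hGI y hy, ← hUV]
    refine setIntegral_congr_set ((hsub x y).eventuallyLE.antisymm ?_)
    exact h.eventuallyLE.trans (union_ae_eq_left_of_ae_eq_empty (ae_eq_empty.2 hN)).le
  have eq_at_f : ∀ x ∈ Icc a b, c x (f x) = F x + G (f x) := by
    intro x hx
    refine young_eq x hx (f x) (hf_maps x hx) _
      (volume_graph_eq_zero (measurable_const (a := f x))) ?_
    rintro p (⟨hp, hpx, h⟩ | ⟨hp, hpy, h⟩)
    · rw [hg_eq _ hp.1] at h
      exact Or.inl ⟨hp, hpx, h.trans (hf_mono hp.1 hx hpx)⟩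
    · rcases hpy.eq_or_lt with hy | hy
      · exact Or.inr hy
      · exact Or.inl ⟨hp, h.trans (finv_le _ _ hx hy), hpy⟩
  have eq_at_finv : ∀ y ∈ Icc A B, c (finv y) y = F (finv y) + G y := by
    intro y hy
    refine young_eq _ (hfinv_mem y) y hy _
      (volume_graph_swap_eq_zero (measurable_const (a := finv y))) ?_
    rintro p (⟨hp, hpx, h⟩ | ⟨hp, hpy, h⟩)
    · rcases hpx.eq_or_lt with hx | hx
      · exact Or.inr hx
      · rw [hg_eq _ hp.1] at h
        exact Or.inl ⟨hp, hpx, h.trans (le_of_not_gt fun hlt => hx.not_ge (finv_le _ _ hp.1 hlt))⟩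
    · exact Or.inl ⟨hp, h.trans (hfinv_mono hpy), hpy⟩
  constructor
  · intro x hx
    symm
    refine IsGreatest.csSup_eq ⟨⟨f x, hf_maps x hx, ?_⟩, ?_⟩
    · simp only [eq_at_f x hx, add_sub_cancel_right]
    · rintro _ ⟨y, hy, rfl⟩
      exact sub_le_iff_le_add.2 (young x hx y hy)
  · intro y hy
    symm
    refine IsGreatest.csSup_eq ⟨⟨finv y, hfinv_mem y, ?_⟩, ?_⟩
    · simp only [eq_at_finv y hy, add_sub_cancel_left]
    · rintro _ ⟨x, hx, rfl⟩
      exact sub_le_iff_le_add'.2 (young x hx y hy)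
end
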